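/- There exists an absolute constant C > 0 such that for every integer N ≥ 1, Σ_{k=0}^{N} σ_k² ≤ C · N^{3/2} · 4^{2N}, where σ_k² = ((2k+1)/2) · 4^{−k} · Σ_{j=0}^{⌊k/2⌋} (C(k,j) · C(2k−2j, k))². -/

import Mathlib

open Finset

/-- `σ_k²`, the sum of the squared coefficients of the normalized Legendre polynomial of
degree `k`: `σ_k² = ((2k+1)/2) · 4^(−k) · Σ_{j=0}^{⌊k/2⌋} (C(k,j) · C(2k−2j, k))²`. -/
noncomputable def sigmaSq (k : ℕ) : ℝ :=
  ((2 * k + 1 : ℝ) / 2) / 4 ^ k *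
    ∑ j ∈ Finset.range (k / 2 + 1),
      ((k.choose j : ℝ) * ((2 * k - 2 * j).choose k : ℝ)) ^ 2

theorem sum_choose_mul_choose_le (k : ℕ) :
    ∑ j ∈ Finset.range (k / 2 + 1), k.choose j * (2 * k - 2 * j).choose k ≤ 8 ^ k := by
  calc ∑ j ∈ Finset.range (k / 2 + 1), k.choose j * (2 * k - 2 * j).choose k
      ≤ ∑ j ∈ Finset.range (k / 2 + 1), k.choose j * 4 ^ k := by
        gcongr with j
        calc (2 * k - 2 * j).choose k ≤ 2 ^ (2 * k - 2 * j) := Nat.choose_le_two_pow _ _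
          _ ≤ 2 ^ (2 * k) := Nat.pow_le_pow_right two_pos (Nat.sub_le _ _)
          _ = 4 ^ k := by rw [pow_mul]; norm_num
    _ ≤ ∑ j ∈ Finset.range (k + 1), k.choose j * 4 ^ k :=
        Finset.sum_le_sum_of_subset (Finset.range_mono (by omega))
    _ = 8 ^ k := by
        rw [← Finset.sum_mul, Nat.sum_range_choose, ← mul_pow]
        norm_num

theorem sigmaSq_le (k : ℕ) : sigmaSq k ≤ (2 * k + 1 : ℝ) / 2 * 16 ^ k := by
  have hsum : ∑ j ∈ Finset.range (k / 2 + 1),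
      ((k.choose j : ℝ) * ((2 * k - 2 * j).choose k : ℝ)) ^ 2 ≤ (8 ^ k) ^ 2 := by
    refine (Finset.sum_sq_le_sq_sum_of_nonneg fun j _ => by positivity).trans ?_
    gcongr
    exact_mod_cast sum_choose_mul_choose_le k
  calc sigmaSq k ≤ ((2 * k + 1 : ℝ) / 2) / 4 ^ k * (8 ^ k) ^ 2 := by
        unfold sigmaSq
        gcongr
    _ = (2 * k + 1 : ℝ) / 2 * 16 ^ k := by
        rw [pow_right_comm, div_mul_eq_mul_div, mul_div_assoc, ← div_pow]
        norm_num

/-- There is an absolute constant `C > 0` such that for every integer `N ≥ 1`,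
`Σ_{k=0}^{N} σ_k² ≤ C · N^(3/2) · 4^(2N)`. -/
theorem sum_sigmaSq_le :
    ∃ C : ℝ, 0 < C ∧ ∀ N : ℕ, 1 ≤ N →
      ∑ k ∈ Finset.range (N + 1), sigmaSq k ≤
        C * (N : ℝ) ^ ((3 : ℝ) / 2) * 4 ^ (2 * N) := by
  refine ⟨2, two_pos, fun N hN => ?_⟩
  have hN' : (1 : ℝ) ≤ N := by exact_mod_cast hN
  have hgeom : ∑ k ∈ Finset.range (N + 1), (16 : ℝ) ^ k ≤ 16 / 15 * 16 ^ N := by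
    rw [geom_sum_eq (by norm_num), pow_succ]
    linarith
  have hpow : (N : ℝ) ≤ (N : ℝ) ^ ((3 : ℝ) / 2) :=
    Real.self_le_rpow_of_one_le hN' (by norm_num)
  calc ∑ k ∈ Finset.range (N + 1), sigmaSq k
      ≤ ∑ k ∈ Finset.range (N + 1), (2 * N + 1 : ℝ) / 2 * 16 ^ k := by
        refine Finset.sum_le_sum fun k hk => (sigmaSq_le k).trans ?_
        gcongr
        exact Nat.lt_succ_iff.mp (Finset.mem_range.mp hk)
    _ ≤ (2 * N + 1 : ℝ) / 2 * (16 / 15 * 16 ^ N) := by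
        rw [← Finset.mul_sum]
        gcongr
    _ = ((2 * N + 1 : ℝ) / 2 * (16 / 15)) * 16 ^ N := by ring
    _ ≤ (2 * (N : ℝ) ^ ((3 : ℝ) / 2)) * 16 ^ N := by
        refine mul_le_mul_of_nonneg_right ?_ (by positivity)
        linarith
    _ = 2 * (N : ℝ) ^ ((3 : ℝ) / 2) * 4 ^ (2 * N) := by
        rw [pow_mul]
        norm_num
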